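/- arXiv:1504.00087 — 3 statements merged into one kernel-verified Lean document; each statement's English description precedes it below -/
import Mathlib

section
/- Let Φ ∈ ℂ^{m×N} have restricted isometry constant δ_{2k} < 1/9. Then for every f, g ∈ ℂ^N and every p with 1 ≤ p ≤ 2, ‖f − g‖_p ≤ C₁₀·k^{1/p−1/2}·‖Φ(f−g)‖₂ + (C₁₁/k^{1−1/p})·( ‖f‖₁ − ‖g‖₁ + 2·σ_k(g)₁ ), where C₁₀ and C₁₁ are constants depending only on δ_{2k}. -/
open Matrix Finset

noncomputable section

/-- `ℓ_p` norm of a complex vector (`p ≥ 1`). -/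
def lpNormC {n : ℕ} (p : ℝ) (x : Fin n → ℂ) : ℝ := (∑ i, ‖x i‖ ^ p) ^ (1 / p)

/-- `ℓ₁` norm of a complex vector. -/
def l1normC {n : ℕ} (x : Fin n → ℂ) : ℝ := ∑ i, ‖x i‖

/-- `ℓ₂` norm of a complex vector. -/
def l2normC {n : ℕ} (x : Fin n → ℂ) : ℝ := Real.sqrt (∑ i, ‖x i‖ ^ 2)

/-- Best `k`-term approximation error in `ℓ₁`: `σ_k(x)₁`. -/
def sigmaKC {n : ℕ} (k : ℕ) (x : Fin n → ℂ) : ℝ :=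
  sInf {t | ∃ v : Fin n → ℂ, (Function.support v).ncard ≤ k ∧ t = l1normC (x - v)}

/-- `A` has restricted isometry constant `δs` at sparsity level `s`:
`(1-δs)‖v‖₂² ≤ ‖Av‖₂² ≤ (1+δs)‖v‖₂²` for all `s`-sparse `v`. -/
def RIPC {m n : ℕ} (A : Matrix (Fin m) (Fin n) ℂ) (s : ℕ) (δs : ℝ) : Prop :=
  ∀ v : Fin n → ℂ, (Function.support v).ncard ≤ s →
    (1 - δs) * l2normC v ^ 2 ≤ l2normC (A.mulVec v) ^ 2 ∧
      l2normC (A.mulVec v) ^ 2 ≤ (1 + δs) * l2normC v ^ 2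

/-- A partition of the indices into consecutive blocks of `k` entries, by decreasing value. -/
lemma exists_block_index {N : ℕ} (a : Fin N → ℝ) {k : ℕ} (hk : 0 < k) :
    ∃ b : Fin N → ℕ, (∀ i, b i < N) ∧ (∀ j, #{i | b i = j} ≤ k) ∧
      (∀ i j, j < b i → #{l | b l = j} = k) ∧ ∀ i l, b l < b i → a i ≤ a l := by
  set σ := Tuple.sort (fun i => -a i) with hσ
  have hmono : Monotone ((fun i => -a i) ∘ σ) := Tuple.monotone_sort _
  have hcard (j : ℕ) : #{i : Fin N | (σ.symm i : ℕ) / k = j} =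
      #{n ∈ range N | n / k = j} := by
    refine Finset.card_bij (fun i _ => (σ.symm i : ℕ)) ?_ ?_ ?_
    · intro i hi
      simpa using hi
    · intro i _ l _ h
      exact σ.symm.injective (Fin.ext h)
    · intro n hn
      simp only [Finset.mem_filter, Finset.mem_range] at hn
      exact ⟨σ ⟨n, hn.1⟩, by simpa using hn.2, by simp⟩
  have hIco (j n : ℕ) : n / k = j ↔ j * k ≤ n ∧ n < j * k + k := by
    rw [Nat.div_eq_iff hk]
    have : j * k + k - 1 + 1 = j * k + k := by omega
    omega
  refine ⟨fun i => (σ.symm i : ℕ) / k, ?_, ?_, ?_, ?_⟩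
  · intro i
    exact (Nat.div_le_self _ _).trans_lt (σ.symm i).2
  · intro j
    rw [hcard]
    calc #{n ∈ range N | n / k = j} ≤ #(Finset.Ico (j * k) (j * k + k)) := by
          apply Finset.card_le_card
          intro n hn
          simp only [Finset.mem_filter, hIco] at hn
          exact Finset.mem_Ico.2 hn.2
      _ = k := by simp
  · intro i j hj
    rw [hcard]
    have hi : (j + 1) * k ≤ (σ.symm i : ℕ) := (Nat.le_div_iff_mul_le hk).1 hj
    have hN := (σ.symm i).2
    have : ({n ∈ range N | n / k = j}) = Finset.Ico (j * k) (j * k + k) := by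
      ext n
      simp only [Finset.mem_filter, hIco, Finset.mem_range, Finset.mem_Ico]
      rw [add_mul, one_mul] at hi
      omega
    rw [this]
    simp
  · intro i l h
    have hle : σ.symm l ≤ σ.symm i := by
      by_contra hlt
      exact absurd h (not_lt.2 (Nat.div_le_div_right (Fin.le_def.1 (not_le.1 hlt).le)))
    simpa using hmono hle

/-- A set of indices carrying the largest values has the largest sum among sets of its size. -/
lemma sum_le_sum_of_card_le_of_forall_le {ι : Type*} [DecidableEq ι] (a : ι → ℝ)
    (ha : ∀ i, 0 ≤ a i) (S T : Finset ι) (hcard : #S ≤ #T)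
    (hT : ∀ i ∉ T, ∀ l ∈ T, a i ≤ a l) : ∑ i ∈ S, a i ≤ ∑ i ∈ T, a i := by
  rcases (S \ T).eq_empty_or_nonempty with he | hne
  · exact Finset.sum_le_sum_of_subset_of_nonneg (Finset.sdiff_eq_empty_iff_subset.1 he)
      fun i _ _ => ha i
  · obtain ⟨i₀, hi₀, hmax⟩ := Finset.exists_max_image (S \ T) a hne
    have h₁ : ∑ i ∈ S \ T, a i ≤ #(S \ T) * a i₀ := by
      simpa using Finset.sum_le_card_nsmul _ _ _ hmax
    have h₂ : #(T \ S) * a i₀ ≤ ∑ i ∈ T \ S, a i := by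
      simpa using Finset.card_nsmul_le_sum (T \ S) a (a i₀) fun l hl =>
        hT i₀ (Finset.mem_sdiff.1 hi₀).2 l (Finset.mem_sdiff.1 hl).1
    have h₃ : (#(S \ T) : ℝ) ≤ #(T \ S) := by
      exact_mod_cast Finset.card_sdiff_le_card_sdiff_iff.2 hcard
    have h₄ := mul_le_mul_of_nonneg_right h₃ (ha i₀)
    have h₅ := Finset.sum_inter_add_sum_sdiff S T a
    have h₆ := Finset.sum_inter_add_sum_sdiff T S a
    rw [Finset.inter_comm] at h₆
    linarith

lemma l2normC_eq_norm {n : ℕ} (x : Fin n → ℂ) : l2normC x = ‖WithLp.toLp 2 x‖ := by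
  simp [l2normC, EuclideanSpace.norm_eq]

lemma sq_l2normC {n : ℕ} (x : Fin n → ℂ) : l2normC x ^ 2 = ∑ i, ‖x i‖ ^ 2 :=
  Real.sq_sqrt (by positivity)

lemma l2normC_nonneg {n : ℕ} (x : Fin n → ℂ) : 0 ≤ l2normC x := Real.sqrt_nonneg _

lemma sq_l2normC_add_of_disjoint {n : ℕ} {x y : Fin n → ℂ} (hxy : ∀ i, x i = 0 ∨ y i = 0)
    (α β : ℝ) : l2normC ((α : ℂ) • x + (β : ℂ) • y) ^ 2 =
      α ^ 2 * l2normC x ^ 2 + β ^ 2 * l2normC y ^ 2 := by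
  simp only [sq_l2normC, Finset.mul_sum, ← Finset.sum_add_distrib]
  refine Finset.sum_congr rfl fun i _ => ?_
  rcases hxy i with h | h <;> simp [h, mul_pow]

/-- Restricted isometries almost preserve orthogonality of disjointly supported vectors. -/
lemma RIPC.neg_re_inner_le {m n s : ℕ} {A : Matrix (Fin m) (Fin n) ℂ} {δ : ℝ}
    (hA : RIPC A s δ) {x y : Fin n → ℂ} (hxy : ∀ i, x i = 0 ∨ y i = 0)
    (hs : (Function.support x ∪ Function.support y).ncard ≤ s) :
    -(inner ℂ (WithLp.toLp 2 (A.mulVec x)) (WithLp.toLp 2 (A.mulVec y))).re ≤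
      δ * l2normC x * l2normC y := by
  have hsupp (α β : ℝ) :
      (Function.support ((α : ℂ) • x + (β : ℂ) • y)).ncard ≤ s := by
    refine (Set.ncard_le_ncard ?_ (Set.toFinite _)).trans hs
    intro i hi
    by_contra hn
    simp only [Set.mem_union, Function.mem_support, not_or, not_not] at hn
    exact hi (by simp [hn.1, hn.2])
  have hexp (α β : ℝ) : l2normC (A.mulVec ((α : ℂ) • x + (β : ℂ) • y)) ^ 2 =
      α ^ 2 * l2normC (A.mulVec x) ^ 2 + 2 * (α * β *
        (inner ℂ (WithLp.toLp 2 (A.mulVec x)) (WithLp.toLp 2 (A.mulVec y))).re) +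
      β ^ 2 * l2normC (A.mulVec y) ^ 2 := by
    rw [Matrix.mulVec_add, Matrix.mulVec_smul, Matrix.mulVec_smul]
    simp only [l2normC_eq_norm, WithLp.toLp_add, WithLp.toLp_smul]
    rw [@norm_add_sq ℂ, norm_smul, norm_smul, inner_smul_left, inner_smul_right]
    simp [mul_pow, mul_assoc]
  have hX := l2normC_nonneg x
  have hY := l2normC_nonneg y
  have hzero (z : Fin n → ℂ) (hz : l2normC z = 0) : z = 0 := by
    rw [l2normC_eq_norm, norm_eq_zero] at hz
    simpa using hz
  rcases hX.eq_or_lt with h0 | hXpos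
  · simp [hzero x h0.symm, l2normC]
  rcases hY.eq_or_lt with h0 | hYpos
  · simp [hzero y h0.symm, l2normC]
  have h₁ := (hA _ (hsupp (l2normC y) (l2normC x))).1
  have h₂ := (hA _ (hsupp (l2normC y) (-l2normC x))).2
  rw [hexp, sq_l2normC_add_of_disjoint hxy] at h₁ h₂
  have hpos : 0 < l2normC x * l2normC y := mul_pos hXpos hYpos
  refine le_of_mul_le_mul_left ?_ hpos
  nlinarith

lemma sum_le_sqrt_mul_l2normC {n k : ℕ} (x : Fin n → ℂ) (T : Finset (Fin n)) (hT : #T ≤ k) :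
    ∑ i ∈ T, ‖x i‖ ≤ √k * √(∑ i ∈ T, ‖x i‖ ^ 2) := by
  rw [← Real.sqrt_mul (by positivity)]
  refine Real.le_sqrt_of_sq_le (sq_sum_le_card_mul_sum_sq.trans ?_)
  gcongr

/-- The restriction of `h` to the block `b = j`. -/
def blockPart {N : ℕ} (b : Fin N → ℕ) (h : Fin N → ℂ) (j : ℕ) : Fin N → ℂ :=
  fun i => if b i = j then h i else 0

lemma l2normC_blockPart {N : ℕ} (b : Fin N → ℕ) (h : Fin N → ℂ) (j : ℕ) :
    l2normC (blockPart b h j) = √(∑ i with b i = j, ‖h i‖ ^ 2) := by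
  rw [l2normC, Finset.sum_filter]
  congr 1
  refine Finset.sum_congr rfl fun i _ => ?_
  by_cases hi : b i = j <;> simp [blockPart, hi]

lemma support_blockPart_subset {N : ℕ} (b : Fin N → ℕ) (h : Fin N → ℂ) (j : ℕ) :
    Function.support (blockPart b h j) ⊆ ({i | b i = j} : Finset (Fin N)) := by
  intro i hi
  by_contra hn
  exact hi (if_neg (by simpa using hn))

lemma sum_blockPart {N : ℕ} (b : Fin N → ℕ) (h : Fin N → ℂ) {n : ℕ} (hb : ∀ i, b i < n) :
    ∑ j ∈ range n, blockPart b h j = h := by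
  ext i
  simp [blockPart, Finset.sum_apply, hb i]

/-- Each block is controlled in `ℓ₂` by the preceding block in `ℓ₁`. -/
lemma sqrt_mul_l2normC_blockPart_succ_le {N k : ℕ} (hk : 0 < k) (b : Fin N → ℕ)
    (h : Fin N → ℂ) (hle : ∀ j, #{i | b i = j} ≤ k)
    (heq : ∀ i j, j < b i → #{l | b l = j} = k)
    (hanti : ∀ i l, b l < b i → ‖h i‖ ≤ ‖h l‖) (j : ℕ) :
    √k * l2normC (blockPart b h (j + 1)) ≤ ∑ i with b i = j, ‖h i‖ := by
  set s := ∑ i with b i = j, ‖h i‖ with hs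
  have hkR : (0 : ℝ) < k := by exact_mod_cast hk
  have hs0 : 0 ≤ s := by positivity
  have hentry : ∀ i ∈ ({i | b i = j + 1} : Finset (Fin N)), ‖h i‖ ^ 2 ≤ (s / k) ^ 2 := by
    intro i hi
    have hi' : b i = j + 1 := by simpa using hi
    have hmul : k * ‖h i‖ ≤ s := by
      rw [← heq i j (by omega), ← nsmul_eq_mul]
      refine Finset.card_nsmul_le_sum _ _ _ fun l hl => hanti i l ?_
      simp only [Finset.mem_filter, Finset.mem_univ, true_and] at hl
      omega
    gcongr
    rw [le_div_iff₀ hkR]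
    linarith
  rw [l2normC_blockPart, ← Real.sqrt_mul hkR.le]
  refine Real.sqrt_le_iff.2 ⟨hs0, ?_⟩
  have hsum : ∑ i with b i = j + 1, ‖h i‖ ^ 2 ≤ k * (s / k) ^ 2 := by
    refine (Finset.sum_le_card_nsmul _ _ _ hentry).trans ?_
    rw [nsmul_eq_mul]
    have : (#{i | b i = j + 1} : ℝ) ≤ k := by exact_mod_cast hle (j + 1)
    gcongr
  calc (k : ℝ) * ∑ i with b i = j + 1, ‖h i‖ ^ 2 ≤ k * (k * (s / k) ^ 2) := by gcongr
    _ = s ^ 2 := by field_simp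

/-- The scalar estimate behind `RIPC.robust_null_space`. -/
lemma le_of_almost_isometry_bounds {δ X U W τ : ℝ} (hδ : δ < 1 / 9) (hX : 0 ≤ X) (hW : 0 ≤ W)
    (hτ : 0 ≤ τ) (hlow : (1 - δ) * X ^ 2 ≤ U ^ 2) (hup : U ^ 2 ≤ (1 + δ) * X ^ 2)
    (h : U ^ 2 ≤ U * W + δ * X * τ) : X ≤ 2 * W + τ / 8 := by
  rcases hX.eq_or_lt with hz | hXpos
  · rw [← hz]; positivity
  have hδX : δ * X ^ 2 ≤ 1 / 9 * X ^ 2 := by gcongr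
  have hUX : U ≤ 4 / 3 * X :=
    (abs_le_of_sq_le_sq' (by linarith [sq_nonneg X, mul_pow (4 / 3) X 2]) (by positivity)).2
  refine le_of_mul_le_mul_left ?_ hXpos
  have h₁ : U * W ≤ 4 / 3 * X * W := by gcongr
  have h₂ : δ * X * τ ≤ 1 / 9 * X * τ := by gcongr
  have h₃ : 0 ≤ X * W := by positivity
  linarith

/-- Robust null space property: some `k`-element set of largest entries of `h` is controlled by
`‖h‖₁` and `‖A h‖₂`. -/
lemma RIPC.robust_null_space {m N k : ℕ} (hk : 0 < k) {A : Matrix (Fin m) (Fin N) ℂ} {δ : ℝ}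
    (hδ : δ < 1 / 9) (hA : RIPC A (2 * k) δ) (h : Fin N → ℂ) :
    ∃ T : Finset (Fin N), (∀ S : Finset (Fin N), #S ≤ k → ∑ i ∈ S, ‖h i‖ ≤ ∑ i ∈ T, ‖h i‖) ∧
      ∑ i ∈ T, ‖h i‖ ≤ l1normC h / 8 + 2 * (√k * l2normC (A.mulVec h)) ∧
      √k * l2normC h ≤ 2 * l1normC h + 2 * (√k * l2normC (A.mulVec h)) := by
  obtain ⟨b, hb, hle, heq, hanti⟩ := exists_block_index (fun i => ‖h i‖) hk
  set P := blockPart b h with hP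
  have hsum : ∑ j ∈ range (N + 1), P j = h := sum_blockPart b h fun i => (hb i).trans N.lt_succ_self
  set τ := ∑ j ∈ range N, l2normC (P (j + 1)) with hτ
  have htail : √k * τ ≤ l1normC h := by
    calc √k * τ ≤ ∑ j ∈ range N, ∑ i with b i = j, ‖h i‖ := by
          rw [hτ, Finset.mul_sum]
          exact Finset.sum_le_sum fun j _ =>
            sqrt_mul_l2normC_blockPart_succ_le hk b h hle heq hanti j
      _ = l1normC h := Finset.sum_fiberwise_of_maps_to (fun i _ => Finset.mem_range.2 (hb i)) _
  have hτ0 : 0 ≤ τ := Finset.sum_nonneg fun _ _ => l2normC_nonneg _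
  have htri : l2normC h ≤ l2normC (P 0) + τ := by
    conv_lhs => rw [← hsum, Finset.sum_range_succ', add_comm]
    simp only [hτ, l2normC_eq_norm, WithLp.toLp_add, WithLp.toLp_sum]
    refine (norm_add_le _ _).trans ?_
    gcongr
    exact norm_sum_le _ _
  have hcardP (j : ℕ) : (Function.support (P j)).ncard ≤ k := by
    refine (Set.ncard_le_ncard (support_blockPart_subset b h j) (Set.toFinite _)).trans ?_
    rw [Set.ncard_coe_finset]
    exact hle j
  have hhead : l2normC (P 0) ≤ 2 * l2normC (A.mulVec h) + τ / 8 := by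
    set u : ℕ → EuclideanSpace ℂ (Fin m) := fun j => WithLp.toLp 2 (A.mulVec (P j)) with hu
    set w : EuclideanSpace ℂ (Fin m) := WithLp.toLp 2 (A.mulVec h) with hw
    have hwu : w = ∑ j ∈ range N, u (j + 1) + u 0 := by
      rw [← Finset.sum_range_succ' u, hw, ← hsum, Matrix.mulVec_sum, WithLp.toLp_sum]
    have hinner : ‖u 0‖ ^ 2 = (inner ℂ (u 0) w).re +
        ∑ j ∈ range N, -(inner ℂ (u 0) (u (j + 1))).re := by
      have := inner_self_eq_norm_sq (𝕜 := ℂ) (u 0)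
      rw [hwu, inner_add_right, inner_sum, Complex.add_re, Complex.re_sum,
        Finset.sum_neg_distrib, ← this]
      simp
    have hcross : ∑ j ∈ range N, -(inner ℂ (u 0) (u (j + 1))).re ≤
        δ * l2normC (P 0) * τ := by
      rw [hτ, Finset.mul_sum]
      refine Finset.sum_le_sum fun j _ => hA.neg_re_inner_le (fun i => ?_) ?_
      · by_cases hi : b i = 0
        · right; simp [hP, blockPart, hi]
        · left; simp [hP, blockPart, hi]
      · refine (Set.ncard_union_le _ _).trans ?_
        have := hcardP 0
        have := hcardP (j + 1)
        omega
    have hre : (inner ℂ (u 0) w).re ≤ ‖u 0‖ * ‖w‖ := re_inner_le_norm (𝕜 := ℂ) _ _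
    obtain ⟨hlow, hup⟩ := hA (P 0) ((hcardP 0).trans (by omega))
    rw [l2normC_eq_norm (A.mulVec (P 0))] at hlow hup
    change _ ≤ ‖u 0‖ ^ 2 at hlow
    change ‖u 0‖ ^ 2 ≤ _ at hup
    rw [l2normC_eq_norm (A.mulVec h)]
    change _ ≤ 2 * ‖w‖ + _
    exact le_of_almost_isometry_bounds hδ (l2normC_nonneg _) (norm_nonneg _) hτ0 hlow hup
      (hinner.le.trans (add_le_add hre hcross))
  have hk0 : 0 ≤ √(k : ℝ) := Real.sqrt_nonneg _
  have hhead' := mul_le_mul_of_nonneg_left hhead hk0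
  have htri' := mul_le_mul_of_nonneg_left htri hk0
  refine ⟨({i | b i = 0} : Finset (Fin N)), fun S hS => ?_, ?_, ?_⟩
  · by_cases hall : ∀ i, b i = 0
    · exact Finset.sum_le_sum_of_subset_of_nonneg (fun i _ => by simp [hall i])
        fun _ _ _ => norm_nonneg _
    · push Not at hall
      obtain ⟨i, hi⟩ := hall
      refine sum_le_sum_of_card_le_of_forall_le _ (fun _ => norm_nonneg _) _ _ ?_ ?_
      · rw [heq i 0 (Nat.pos_of_ne_zero hi)]
        exact hS
      · intro i hi l hl
        simp only [Finset.mem_filter, Finset.mem_univ, true_and] at hi hl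
        exact hanti i l (by omega)
  · have := sum_le_sqrt_mul_l2normC h _ (hle 0)
    rw [← l2normC_blockPart] at this
    linarith
  · have : 0 ≤ l1normC h := Finset.sum_nonneg fun _ _ => norm_nonneg _
    linarith

/-- The `ℓ₁` mass of `f - g` off a set of its `k` largest entries exceeds the mass on it by at most
`‖f‖₁ - ‖g‖₁ + 2 σ_k(g)₁`. -/
lemma l1normC_sub_sub_le {N k : ℕ} (f g : Fin N → ℂ) (a : ℝ)
    (ha : ∀ S : Finset (Fin N), #S ≤ k → ∑ i ∈ S, ‖(f - g) i‖ ≤ a) :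
    l1normC (f - g) - 2 * a ≤ l1normC f - l1normC g + 2 * sigmaKC k g := by
  suffices (l1normC (f - g) - 2 * a - l1normC f + l1normC g) / 2 ≤ sigmaKC k g by linarith
  refine le_csInf ⟨l1normC (g - 0), 0, by simp, rfl⟩ ?_
  rintro _ ⟨v, hv, rfl⟩
  classical
  set S : Finset (Fin N) := {i | v i ≠ 0} with hS
  have hScard : #S ≤ k := by
    rw [← Set.ncard_coe_finset]
    convert hv using 2
    ext i
    simp [hS]
  have hpt : ∀ i, ‖(f - g) i‖ - ‖f i‖ + ‖g i‖ ≤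
      2 * ‖(g - v) i‖ + 2 * (if v i ≠ 0 then ‖(f - g) i‖ else 0) := by
    intro i
    by_cases hi : v i = 0
    · have := norm_sub_le (f i) (g i)
      simp only [Pi.sub_apply, hi, sub_zero, ne_eq, not_true_eq_false, if_false]
      linarith
    · have := norm_sub_norm_le (g i) (f i)
      rw [norm_sub_rev] at this
      have := norm_nonneg ((g - v) i)
      simp only [Pi.sub_apply, ne_eq, hi, not_false_eq_true, if_true] at *
      linarith
  have hsum := Finset.sum_le_sum fun i (_ : i ∈ Finset.univ) => hpt i
  simp only [Finset.sum_add_distrib, Finset.sum_sub_distrib, ← Finset.mul_sum] at hsum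
  rw [← Finset.sum_filter] at hsum
  have := ha S hScard
  simp only [l1normC]
  linarith

/-- Interpolation between `ℓ₁` and `ℓ₂`. -/
lemma lpNormC_le_of_l1normC_le_of_l2normC_le {N k : ℕ} (hk : 0 < k) (h : Fin N → ℂ) {M p : ℝ}
    (hp₁ : 1 ≤ p) (hp₂ : p ≤ 2) (h₁ : l1normC h ≤ M) (h₂ : √k * l2normC h ≤ M) :
    lpNormC p h ≤ M / (k : ℝ) ^ (1 - 1 / p) := by
  have hkR : (0 : ℝ) < k := by exact_mod_cast hk
  have hp : 0 < p := by linarith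
  have hM0 : 0 ≤ M := (Finset.sum_nonneg fun _ _ => norm_nonneg _ : 0 ≤ l1normC h).trans h₁
  rcases hM0.eq_or_lt with rfl | hM
  · have hz : ∀ i, ‖h i‖ = 0 := fun i =>
      (Finset.sum_eq_zero_iff_of_nonneg fun _ _ => norm_nonneg _).1
        (h₁.antisymm (Finset.sum_nonneg fun _ _ => norm_nonneg _)) i (Finset.mem_univ i)
    simp [lpNormC, hz, Real.zero_rpow hp.ne', hp.ne']
  have hsq : k * ∑ i, ‖h i‖ ^ 2 ≤ M ^ 2 := by
    have := pow_le_pow_left₀ (mul_nonneg (Real.sqrt_nonneg _) (l2normC_nonneg h)) h₂ 2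
    rwa [mul_pow, Real.sq_sqrt hkR.le, sq_l2normC] at this
  have hpt (i : Fin N) : (k : ℝ) ^ (p - 1) / M ^ p * ‖h i‖ ^ p ≤
      (2 - p) / M * ‖h i‖ + (p - 1) / M ^ 2 * (k * ‖h i‖ ^ 2) := by
    set t := ‖h i‖
    have ht : 0 ≤ t := norm_nonneg _
    have hgm := Real.geom_mean_le_arith_mean2_weighted (sub_nonneg.2 hp₂) (sub_nonneg.2 hp₁)
      (div_nonneg ht hM.le) (show 0 ≤ k * (t / M) ^ 2 by positivity) (by ring)
    have heq : (t / M) ^ (2 - p) * (k * (t / M) ^ 2) ^ (p - 1) =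
        (k : ℝ) ^ (p - 1) / M ^ p * t ^ p := by
      have hu : 0 ≤ t / M := by positivity
      rw [Real.mul_rpow hkR.le (by positivity), ← Real.rpow_natCast, ← Real.rpow_mul hu,
        mul_left_comm, ← Real.rpow_add_of_nonneg hu (by linarith) (by push_cast; linarith)]
      rw [show 2 - p + ((2 : ℕ) : ℝ) * (p - 1) = p by push_cast; ring, Real.div_rpow ht hM.le]
      ring
    rw [heq] at hgm
    refine hgm.trans (le_of_eq ?_)
    ring
  have hsum := Finset.sum_le_sum fun i (_ : i ∈ Finset.univ) => hpt i
  rw [Finset.sum_add_distrib] at hsum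
  simp only [← Finset.mul_sum] at hsum
  have hone : (2 - p) / M * ∑ i, ‖h i‖ + (p - 1) / M ^ 2 * (k * ∑ i, ‖h i‖ ^ 2) ≤ 1 := by
    have ha : (2 - p) / M * ∑ i, ‖h i‖ ≤ (2 - p) / M * M :=
      mul_le_mul_of_nonneg_left h₁ (div_nonneg (by linarith) hM.le)
    have hb : (p - 1) / M ^ 2 * (k * ∑ i, ‖h i‖ ^ 2) ≤ (p - 1) / M ^ 2 * M ^ 2 :=
      mul_le_mul_of_nonneg_left hsq (div_nonneg (by linarith) (by positivity))
    rw [div_mul_cancel₀ _ hM.ne'] at ha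
    rw [div_mul_cancel₀ _ (by positivity)] at hb
    linarith
  have hpow : ∑ i, ‖h i‖ ^ p ≤ (M / (k : ℝ) ^ (1 - 1 / p)) ^ p := by
    rw [Real.div_rpow hM.le (by positivity), ← Real.rpow_mul hkR.le,
      show (1 - 1 / p) * p = p - 1 by field_simp, le_div_iff₀ (by positivity)]
    have := hsum.trans hone
    rw [div_mul_eq_mul_div, div_le_one (by positivity)] at this
    linarith
  rw [lpNormC, one_div p, Real.rpow_inv_le_iff_of_pos (by positivity) (by positivity) hp]
  simpa using hpow

/-- **Proposition (ℓ_p instance optimality).** If `Φ ∈ ℂ^{m×N}` has restricted isometry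
constant `δ_{2k} < 1/9`, then for all `f, g` and `1 ≤ p ≤ 2`,
`‖f-g‖_p ≤ C₁₀ k^{1/p-1/2} ‖Φ(f-g)‖₂ + C₁₁ k^{1/p-1} (‖f‖₁ - ‖g‖₁ + 2 σ_k(g)₁)`,
where `C₁₀, C₁₁` depend only on `δ_{2k}`. -/
theorem rip_instance_optimality (δ₂ : ℝ) (hδ₂0 : 0 ≤ δ₂) (hδ₂ : δ₂ < 1 / 9) :
    ∃ C₁₀ C₁₁ : ℝ, 0 < C₁₀ ∧ 0 < C₁₁ ∧
      ∀ (m N k : ℕ), 0 < k →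
      ∀ Φ : Matrix (Fin m) (Fin N) ℂ, RIPC Φ (2 * k) δ₂ →
      ∀ (f g : Fin N → ℂ) (p : ℝ), 1 ≤ p → p ≤ 2 →
        lpNormC p (f - g) ≤
          C₁₀ * (k : ℝ) ^ (1 / p - 1 / 2) * l2normC (Φ.mulVec (f - g)) +
            C₁₁ / (k : ℝ) ^ (1 - 1 / p) *
              (l1normC f - l1normC g + 2 * sigmaKC k g) := by
  refine ⟨38 / 3, 8 / 3, by norm_num, by norm_num, ?_⟩
  intro m N k hk Φ hΦ f g p hp₁ hp₂
  have hkR : (0 : ℝ) < k := by exact_mod_cast hk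
  obtain ⟨T, hT, hhead, hl2⟩ := hΦ.robust_null_space hk hδ₂ (f - g)
  have hE := l1normC_sub_sub_le f g _ hT
  have hD : 0 ≤ √k * l2normC (Φ.mulVec (f - g)) :=
    mul_nonneg (Real.sqrt_nonneg _) (l2normC_nonneg _)
  have hl1 : 0 ≤ l1normC (f - g) := Finset.sum_nonneg fun _ _ => norm_nonneg _
  set E := l1normC f - l1normC g + 2 * sigmaKC k g
  refine (lpNormC_le_of_l1normC_le_of_l2normC_le hk (f - g)
    (M := 38 / 3 * (√k * l2normC (Φ.mulVec (f - g))) + 8 / 3 * E) hp₁ hp₂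
    (by linarith) (by linarith)).trans (le_of_eq ?_)
  have hexp : (k : ℝ) ^ (1 / p - 1 / 2) = √k / (k : ℝ) ^ (1 - 1 / p) := by
    rw [Real.sqrt_eq_rpow, ← Real.rpow_sub hkR]
    congr 1
    ring
  rw [hexp]
  ring

end
end

section
/- Feasible-point bound: Let r ≥ 1, δ > 0, γ > 0, ε > 0, set γ̃ := γ/δ, and let H := [γ̃·D^r, (ε/δ)·I] be the m×2m horizontal concatenation, with Moore–Penrose pseudo-inverse H†. Let Φ ∈ ℝ^{m×N} and q ∈ ℝ^m. Then every pair (z, ν) ∈ ℝ^N × ℝ^m satisfying ‖D^{−r}(Φz + ν − q)‖₂ ≤ γ·√m and ‖ν‖₂ ≤ ε·√m also satisfies ‖H†(Φz − q)‖₂ ≤ δ·√(2m). -/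
open Matrix Finset

noncomputable section

/-- The `m × m` first-order difference matrix: `1` on the diagonal, `-1` on the subdiagonal. -/
def diffM (m : ℕ) : Matrix (Fin m) (Fin m) ℝ :=
  Matrix.of fun i j => if (i : ℕ) = (j : ℕ) then 1
    else if (i : ℕ) = (j : ℕ) + 1 then -1 else 0

/-- Euclidean (`ℓ₂`) norm of a vector. -/
def l2norm {ι : Type*} [Fintype ι] (x : ι → ℝ) : ℝ := Real.sqrt (∑ i, (x i) ^ 2)

/-- The `m × 2m` horizontal concatenation `[A, c·I]`. -/
def augMat (m : ℕ) (A : Matrix (Fin m) (Fin m) ℝ) (c : ℝ) :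
    Matrix (Fin m) (Fin (2 * m)) ℝ :=
  Matrix.of fun i j =>
    if h : (j : ℕ) < m then A i ⟨j, h⟩ else c * (if (i : ℕ) + m = (j : ℕ) then 1 else 0)

/-- `G` is the Moore–Penrose pseudo-inverse of `H`. -/
def IsMoorePenrose {a b : ℕ} (H : Matrix (Fin a) (Fin b) ℝ)
    (G : Matrix (Fin b) (Fin a) ℝ) : Prop :=
  H * G * H = H ∧ G * H * G = G ∧ (H * G)ᵀ = H * G ∧ (G * H)ᵀ = G * H

lemma sum_fin_two_mul {M : Type*} [AddCommMonoid M] (m : ℕ) (f : Fin (2 * m) → M) :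
    ∑ j, f j = ∑ i : Fin m, f ⟨i, by omega⟩ + ∑ i : Fin m, f ⟨m + i, by omega⟩ := by
  rw [← Equiv.sum_comp (finCongr (two_mul m).symm) f, Fin.sum_univ_add]
  rfl

/-- The vertical concatenation of two vectors of length `m`. -/
def stackVec {m : ℕ} (x y : Fin m → ℝ) : Fin (2 * m) → ℝ :=
  fun j => if h : (j : ℕ) < m then x ⟨j, h⟩ else y ⟨j - m, by omega⟩

lemma augMat_mulVec_stackVec {m : ℕ} (A : Matrix (Fin m) (Fin m) ℝ) (c : ℝ) (x y : Fin m → ℝ) :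
    (augMat m A c).mulVec (stackVec x y) = A.mulVec x + c • y := by
  ext i
  simp only [Matrix.mulVec, dotProduct, Pi.add_apply, Pi.smul_apply, smul_eq_mul]
  rw [sum_fin_two_mul]
  congr 1
  · simp [augMat, stackVec]
  · rw [Finset.sum_eq_single i]
    · simp [augMat, stackVec, add_comm]
    · intro b _ hb
      have hne : (i : ℕ) + m ≠ m + b := fun h => hb (Fin.ext (by omega))
      simp [augMat, hne]
    · simp

lemma sum_sq_stackVec {m : ℕ} (x y : Fin m → ℝ) :
    ∑ j, stackVec x y j ^ 2 = ∑ i, x i ^ 2 + ∑ i, y i ^ 2 := by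
  rw [sum_fin_two_mul]
  simp [stackVec]

/-- An orthogonal projection does not increase the Euclidean norm. -/
lemma sum_sq_mulVec_le {ι : Type*} [Fintype ι] (P : Matrix ι ι ℝ) (hsymm : Pᵀ = P)
    (hidem : P * P = P) (v : ι → ℝ) : ∑ i, (P.mulVec v) i ^ 2 ≤ ∑ i, v i ^ 2 := by
  have hinner : v ⬝ᵥ P.mulVec v = P.mulVec v ⬝ᵥ P.mulVec v := by
    rw [Matrix.dotProduct_mulVec (P.mulVec v), ← Matrix.mulVec_transpose, hsymm,
      Matrix.mulVec_mulVec, hidem, dotProduct_comm]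
  have hnonneg : 0 ≤ ∑ i, (v i - (P.mulVec v) i) ^ 2 := Finset.sum_nonneg fun i _ => sq_nonneg _
  have hexpand : ∑ i, (v i - (P.mulVec v) i) ^ 2
      = ∑ i, v i ^ 2 - 2 * (v ⬝ᵥ P.mulVec v) + ∑ i, (P.mulVec v) i ^ 2 := by
    simp only [dotProduct, Finset.mul_sum, ← Finset.sum_sub_distrib, ← Finset.sum_add_distrib]
    exact Finset.sum_congr rfl fun i _ => by ring
  have hself : P.mulVec v ⬝ᵥ P.mulVec v = ∑ i, (P.mulVec v) i ^ 2 := by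
    simp only [dotProduct, sq]
  linarith

lemma det_diffM (m : ℕ) : (diffM m).det = 1 := by
  rw [Matrix.det_of_isLowerTriangular]
  · simp [diffM]
  · intro i j hij
    have hlt : (i : ℕ) < j := hij
    simp [diffM, hlt.ne, (show (i : ℕ) ≠ j + 1 by omega)]

lemma sum_sq_le_of_l2norm_le {ι : Type*} [Fintype ι] {x : ι → ℝ} {c : ℝ} {m : ℕ} (hc : 0 ≤ c)
    (h : l2norm x ≤ c * Real.sqrt m) : ∑ i, x i ^ 2 ≤ c ^ 2 * m := by
  have := (Real.sqrt_le_left (by positivity)).1 h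
  rwa [mul_pow, Real.sq_sqrt (Nat.cast_nonneg m)] at this

/-- **Lemma (feasible-point bound).** With `γ̃ = γ/δ` and `H = [γ̃ D^r, (ε/δ) I]`, any pair
`(z, ν)` feasible for the Σ∆ decoding program (`‖D^{-r}(Φz + ν - q)‖₂ ≤ γ√m`, `‖ν‖₂ ≤ ε√m`)
satisfies `‖H†(Φz - q)‖₂ ≤ δ√(2m)`. -/
theorem feasible_point_bound (m N r : ℕ) (hm : 0 < m) (hr : 1 ≤ r)
    (δ γ ε : ℝ) (hδ : 0 < δ) (hγ : 0 < γ) (hε : 0 < ε)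
    (G : Matrix (Fin (2 * m)) (Fin m) ℝ)
    (hG : IsMoorePenrose (augMat m ((γ / δ) • ((diffM m) ^ r)) (ε / δ)) G)
    (Φ : Matrix (Fin m) (Fin N) ℝ) (q : Fin m → ℝ) (z : Fin N → ℝ) (ν : Fin m → ℝ)
    (hfeas1 : l2norm (((diffM m ^ r)⁻¹).mulVec (Φ.mulVec z + ν - q)) ≤ γ * Real.sqrt m)
    (hfeas2 : l2norm ν ≤ ε * Real.sqrt m) :
    l2norm (G.mulVec (Φ.mulVec z - q)) ≤ δ * Real.sqrt (2 * m) := by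
  obtain ⟨-, hGHG, -, hsymm⟩ := hG
  have hunit : IsUnit (diffM m ^ r).det := by simp [Matrix.det_pow, det_diffM]
  set H := augMat m ((γ / δ) • diffM m ^ r) (ε / δ)
  set u := ((diffM m ^ r)⁻¹).mulVec (Φ.mulVec z + ν - q) with hu
  have hDu : (diffM m ^ r).mulVec u = Φ.mulVec z + ν - q := by
    rw [hu, Matrix.mulVec_mulVec, Matrix.mul_nonsing_inv _ hunit, Matrix.one_mulVec]
  have hpre : H.mulVec (stackVec ((δ / γ) • u) (-(δ / ε) • ν)) = Φ.mulVec z - q := by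
    rw [augMat_mulVec_stackVec, Matrix.smul_mulVec, Matrix.mulVec_smul, hDu, smul_smul, smul_smul,
      show γ / δ * (δ / γ) = 1 by field_simp, show ε / δ * -(δ / ε) = -1 by field_simp]
    simp only [one_smul, neg_smul]
    abel
  have hidem : G * H * (G * H) = G * H := by rw [← Matrix.mul_assoc, hGHG]
  have hu2 := sum_sq_le_of_l2norm_le hγ.le hfeas1
  have hν2 := sum_sq_le_of_l2norm_le hε.le hfeas2
  rw [← hpre, Matrix.mulVec_mulVec]
  refine (Real.sqrt_le_left (by positivity)).2 ?_
  refine (sum_sq_mulVec_le _ hsymm hidem _).trans ?_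
  rw [sum_sq_stackVec, mul_pow, Real.sq_sqrt (by positivity)]
  simp only [Pi.smul_apply, smul_eq_mul, mul_pow, ← Finset.mul_sum, neg_sq]
  calc (δ / γ) ^ 2 * ∑ i, u i ^ 2 + (δ / ε) ^ 2 * ∑ i, ν i ^ 2
      ≤ (δ / γ) ^ 2 * (γ ^ 2 * m) + (δ / ε) ^ 2 * (ε ^ 2 * m) := by gcongr
    _ = δ ^ 2 * (2 * m) := by field_simp; ring

end
end

section
/- Stability of the greedy r-th order Σ∆ scheme: Let δ > 0, let A_K^δ = {±(2j−1)δ/2 : j = 1,…,K} be the 2K-level midrise alphabet with step size δ, and let y ∈ ℝ^m. Run the greedy r-th order Σ∆ recursion with zero initial state: for n = 1,…,m, q_n := Q(ρ_n) where ρ_n := Σ_{j=1}^{r} (−1)^{j−1}·C(r,j)·u_{n−j} + y_n, Q is the scalar quantizer Q(w) ∈ argmin over v ∈ A_K^δ of |v−w|, and u_n := ρ_n − q_n (equivalently u_n = y_n − q_n − Σ_{j=1}^{r} C(r,j)(−1)^j u_{n−j}). If K ≥ 2·⌈‖y‖_∞/δ⌉ + 2^r + 1, then the state sequence satisfies |u_n|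 ≤ δ/2 for all n. -/
open Finset

noncomputable section

/-- The `2K`-level midrise alphabet with step size `δ`. -/
def midrise (K : ℕ) (δ : ℝ) : Set ℝ :=
  {a | ∃ j : ℕ, 1 ≤ j ∧ j ≤ K ∧
    (a = (2 * (j : ℝ) - 1) * δ / 2 ∨ a = -((2 * (j : ℝ) - 1) * δ / 2))}

theorem exists_midrise_near_of_nonneg {K : ℕ} (hK : 1 ≤ K) {δ w : ℝ} (hδ : 0 < δ)
    (hw0 : 0 ≤ w) (hw : w ≤ K * δ) :
    ∃ j : ℕ, 1 ≤ j ∧ j ≤ K ∧ |(2 * (j : ℝ) - 1) * δ / 2 - w| ≤ δ / 2 := by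
  rcases hw0.eq_or_lt with rfl | hpos
  · refine ⟨1, le_rfl, hK, ?_⟩
    rw [abs_le]
    constructor <;> push_cast <;> linarith
  · have hdiv : 0 < w / δ := div_pos hpos hδ
    refine ⟨⌈w / δ⌉₊, Nat.one_le_iff_ne_zero.mpr (Nat.ceil_pos.mpr hdiv).ne',
      Nat.ceil_le.mpr ((div_le_iff₀ hδ).mpr hw), ?_⟩
    have hle : w ≤ ⌈w / δ⌉₊ * δ := (div_le_iff₀ hδ).mp (Nat.le_ceil _)
    have hlt : (⌈w / δ⌉₊ : ℝ) * δ < w + δ := by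
      have h := mul_lt_mul_of_pos_right (Nat.ceil_lt_add_one hdiv.le) hδ
      rwa [add_mul, div_mul_cancel₀ _ hδ.ne', one_mul] at h
    rw [abs_le]
    constructor <;> linarith

/-- Every point of `[-Kδ, Kδ]` is within `δ / 2` of the midrise alphabet. -/
theorem exists_mem_midrise_abs_sub_le {K : ℕ} (hK : 1 ≤ K) {δ w : ℝ} (hδ : 0 < δ)
    (hw : |w| ≤ K * δ) : ∃ a ∈ midrise K δ, |a - w| ≤ δ / 2 := by
  obtain ⟨j, hj1, hjK, hj⟩ := exists_midrise_near_of_nonneg hK hδ (abs_nonneg w) hw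
  rcases abs_cases w with ⟨h, -⟩ | ⟨h, -⟩ <;> rw [h] at hj
  · exact ⟨_, ⟨j, hj1, hjK, Or.inl rfl⟩, hj⟩
  · refine ⟨_, ⟨j, hj1, hjK, Or.inr rfl⟩, ?_⟩
    rw [← abs_neg]
    convert hj using 2
    ring

theorem sum_Icc_one_choose (r : ℕ) :
    ∑ j ∈ Finset.Icc 1 r, (r.choose j : ℝ) = 2 ^ r - 1 := by
  have h : (∑ j ∈ Finset.range (r + 1), (r.choose j : ℝ)) = 2 ^ r := by
    exact_mod_cast Nat.sum_range_choose r
  rw [Finset.range_eq_Ico, Finset.sum_eq_sum_Ico_succ_bot (Nat.succ_pos r)] at h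
  simp only [Nat.choose_zero_right, Nat.cast_one, zero_add] at h
  rw [← Finset.Ico_add_one_right_eq_Icc, eq_sub_iff_add_eq, add_comm]
  exact h

theorem abs_sum_alternating_choose_mul_le (r : ℕ) {c : ℝ} (v : ℕ → ℝ)
    (hv : ∀ j ∈ Finset.Icc 1 r, |v j| ≤ c) :
    |∑ j ∈ Finset.Icc 1 r, (-1 : ℝ) ^ (j - 1) * (r.choose j : ℝ) * v j| ≤ (2 ^ r - 1) * c := by
  rw [← sum_Icc_one_choose, Finset.sum_mul]
  refine (Finset.abs_sum_le_sum_abs _ _).trans (Finset.sum_le_sum fun j hj => ?_)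
  rw [abs_mul, abs_mul, abs_pow, abs_neg, abs_one, one_pow, one_mul, Nat.abs_cast]
  exact mul_le_mul_of_nonneg_left (hv j hj) (Nat.cast_nonneg _)

/-- **Proposition (stability of the greedy `r`-th order Σ∆ scheme).** Run the greedy `r`-th
order Σ∆ recursion with the `2K`-level midrise alphabet of step `δ` and zero initial state:
`ρ_n = ∑_{j=1}^r (-1)^{j-1} C(r,j) u_{n-j} + y_n`, `q_n` a nearest alphabet element to `ρ_n`,
and `u_n = ρ_n - q_n`.  If `K ≥ 2⌈‖y‖_∞/δ⌉ + 2^r + 1` then `|u_n| ≤ δ/2` for all `n`. -/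
theorem greedy_sigma_delta_stability (m r K : ℕ) (hr : 1 ≤ r) (δ : ℝ) (hδ : 0 < δ)
    (y : Fin m → ℝ) (q : ℕ → ℝ) (u : ℤ → ℝ) (ρ : Fin m → ℝ)
    (hu0 : ∀ j : ℤ, j ≤ 0 → u j = 0)
    (hρ : ∀ n : Fin m, ρ n =
      (∑ j ∈ Finset.Icc 1 r, (-1 : ℝ) ^ (j - 1) * (r.choose j : ℝ) *
        u (((n : ℕ) + 1 : ℤ) - j)) + y n)
    (hqmem : ∀ n : Fin m, q ((n : ℕ) + 1) ∈ midrise K δ)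
    (hqnear : ∀ n : Fin m, ∀ a ∈ midrise K δ, |q ((n : ℕ) + 1) - ρ n| ≤ |a - ρ n|)
    (hurec : ∀ n : Fin m, u ((n : ℕ) + 1) = ρ n - q ((n : ℕ) + 1))
    (hK : ∀ i, 2 * ⌈|y i| / δ⌉₊ + 2 ^ r + 1 ≤ K) :
    ∀ n : Fin m, |u ((n : ℕ) + 1)| ≤ δ / 2 := by
  rintro ⟨n, hn⟩
  induction n using Nat.strong_induction_on with
  | _ n ih =>
  have hprev : ∀ j ∈ Finset.Icc 1 r, |u ((n + 1 : ℤ) - j)| ≤ δ / 2 := by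
    intro j hj
    have hj1 := (Finset.mem_Icc.mp hj).1
    rcases le_or_gt j n with hjn | hjn
    · have h := ih (n - j) (by omega) (by omega)
      have hidx : (n + 1 : ℤ) - j = ((n - j : ℕ) : ℤ) + 1 := by omega
      rw [hidx]
      exact h
    · rw [hu0 _ (by omega), abs_zero]
      positivity
  have hsum := abs_sum_alternating_choose_mul_le r (fun j => u ((n + 1 : ℤ) - j)) hprev
  have hy : |y ⟨n, hn⟩| ≤ ⌈|y ⟨n, hn⟩| / δ⌉₊ * δ := (div_le_iff₀ hδ).mp (Nat.le_ceil _)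
  have hKn := hK ⟨n, hn⟩
  have hKδ : (2 * (⌈|y ⟨n, hn⟩| / δ⌉₊ : ℝ) + 2 ^ r + 1) * δ ≤ K * δ :=
    mul_le_mul_of_nonneg_right (by exact_mod_cast hKn) hδ.le
  have hρK : |ρ ⟨n, hn⟩| ≤ K * δ := by
    rw [hρ]
    refine (abs_add_le _ _).trans ((add_le_add hsum le_rfl).trans ?_)
    have hpow : 0 ≤ (2 : ℝ) ^ r * δ := by positivity
    linarith [abs_nonneg (y ⟨n, hn⟩)]
  obtain ⟨a, ha, hnear⟩ := exists_mem_midrise_abs_sub_le ((Nat.le_add_left _ _).trans hKn) hδ hρK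
  rw [hurec, abs_sub_comm]
  exact (hqnear _ a ha).trans hnear

end
end
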